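/- If G₁ and G₂ are ensnaring graphs, then any wedge of G₁ and G₂ (the graph obtained by identifying a chosen vertex of G₁ with a chosen vertex of G₂) is ensnaring. -/

import Mathlib

open scoped Classical

/-- The state space `Ξₙ` for a graph on vertex set `V` with `n = |V|`: a state `(v, i, ε)`
consists of a bijection `v` from the vertices to the positions `ℤ/n` (the replica of vertex
`a` sits at position `v a`; positions increase clockwise), the index `i : ℤ/n`, and the
orientation `ε ∈ {±1}` encoded as a `Bool` (`true` = `+1`, `false` = `-1`). -/
abbrev Xi (V : Type*) [Fintype V] : Type _ :=
  (V ≃ ZMod (Fintype.card V)) × ZMod (Fintype.card V) × Bool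

/-- The orientation `ε` as an element of `ℤ/n`. -/
def epsZ (n : ℕ) (e : Bool) : ZMod n := if e then 1 else -1

/-- Refractive toric promotion `Θ_G`:
`Θ_G (v,i,ε) = (s̄ᵢ v, i+ε, ε)` if `{v⁻¹(i), v⁻¹(i+1)}` is not an edge of `G`, and
`Θ_G (v,i,ε) = (s̄ᵢ v, i−ε, −ε)` if it is an edge of `G`.  Here `s̄ᵢ v` swaps the replicas
sitting at positions `i` and `i+1`. -/
noncomputable def theta {V : Type*} [Fintype V] (G : SimpleGraph V) (D : Xi V) : Xi V :=
  if G.Adj (D.1.symm D.2.1) (D.1.symm (D.2.1 + 1)) then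
    (D.1.trans (Equiv.swap D.2.1 (D.2.1 + 1)), D.2.1 - epsZ _ D.2.2, !D.2.2)
  else
    (D.1.trans (Equiv.swap D.2.1 (D.2.1 + 1)), D.2.1 + epsZ _ D.2.2, D.2.2)

/-- The net number of clockwise steps that the replica of vertex `a` makes during one
application of `Θ_G` to the state `D`: each application swaps the replicas at positions
`i` and `i+1`, moving the former one step clockwise and the latter one step
counterclockwise. -/
def disp {V : Type*} [Fintype V] (D : Xi V) (a : V) : ℤ :=
  if D.1 a = D.2.1 then 1 else if D.1 a = D.2.1 + 1 then -1 else 0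

/-- `n` times the winding number `w_O(a)` of vertex `a` with respect to the orbit `O` of the
state `D` under `Θ_G`: the net number of clockwise steps made by the replica of `a` during
`P` consecutive applications of `Θ_G` starting from `D`, where `P` is the size of the orbit
(i.e. the minimal period of `D`).  The winding number itself is `windSum G D a / n`; in
particular `w_O(a) = 0` iff `windSum G D a = 0`, and `w_O(a) = w_O(b)` iff
`windSum G D a = windSum G D b`. -/
noncomputable def windSum {V : Type*} [Fintype V] (G : SimpleGraph V) (D : Xi V) (a : V) : ℤ :=
  ∑ k ∈ Finset.range (Function.minimalPeriod (theta G) D), disp ((theta G)^[k] D) a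

/-- The winding vector of the orbit of `D` under `Θ_G` is zero. -/
def WindingVectorZero {V : Type*} [Fintype V] (G : SimpleGraph V) (D : Xi V) : Prop :=
  ∀ a : V, windSum G D a = 0

/-- `G` is ensnaring if every orbit of `Θ_G` has winding vector `0`.  By the convention of
the paper, a graph with exactly one vertex is ensnaring. -/
def Ensnaring {V : Type*} [Fintype V] (G : SimpleGraph V) : Prop :=
  Fintype.card V = 1 ∨ ∀ D : Xi V, WindingVectorZero G D

/-- The wedge of `G₁` and `G₂` at vertices `v₁` and `v₂`: the graph obtained from the
disjoint union of `G₁` and `G₂` by identifying `v₁` with `v₂`.  Its vertex set is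
`V₁ ⊕ {y : V₂ // y ≠ v₂}`, the identified vertex being `Sum.inl v₁`. -/
def wedge {V₁ V₂ : Type*} [DecidableEq V₂] (G₁ : SimpleGraph V₁) (G₂ : SimpleGraph V₂)
    (v₁ : V₁) (v₂ : V₂) : SimpleGraph (V₁ ⊕ {y : V₂ // y ≠ v₂}) :=
  SimpleGraph.fromRel (fun x y =>
    match x, y with
    | Sum.inl a, Sum.inl b => G₁.Adj a b
    | Sum.inl a, Sum.inr b => a = v₁ ∧ G₂.Adj v₂ b.1
    | Sum.inr a, Sum.inr b => G₂.Adj a.1 b.1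
    | Sum.inr _, Sum.inl _ => False)


def sg (e : Bool) : ℤ := if e then 1 else -1

structure LS (V : Type*) where
  x : V → ℤ
  m : V
  e : Bool

def Good {V : Type*} (n : ℕ) (x : V → ℤ) : Prop := ∀ a b, (n : ℤ) ∣ x a - x b → a = b

/-- position data of a step -/
def PStep {V : Type*} (n : ℕ) (s s' : LS V) (q : V) : Prop :=
  q ≠ s.m ∧ (∃ j : ℤ, s.x q = s.x s.m + sg s.e + n * j) ∧
  (∀ a, s'.x a = s.x a + sg s.e * ((if a = s.m then 1 else 0) - (if a = q then 1 else 0)))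

def Step {V : Type*} (G : SimpleGraph V) (n : ℕ) (s s' : LS V) (q : V) : Prop :=
  PStep n s s' q ∧ ((G.Adj s.m q ∧ s'.m = q ∧ s'.e = !s.e) ∨
    (¬ G.Adj s.m q ∧ s'.m = s.m ∧ s'.e = s.e))

def LS.R {V : Type*} (s : LS V) : LS V := ⟨s.x, s.m, !s.e⟩

lemma LS.R_R {V : Type*} (s : LS V) : s.R.R = s := by
  cases s; simp [LS.R]

lemma sg_not (e : Bool) : sg (!e) = - sg e := by cases e <;> simp [sg]

lemma Step.rev {V : Type*} {G : SimpleGraph V} {n : ℕ} {s s' : LS V} {q : V}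
    (h : Step G n s s' q) : ∃ r, Step G n s'.R s.R r := by
  obtain ⟨⟨h1, ⟨j, hj⟩, h3⟩, h4⟩ := h
  have hm := h3 s.m
  have hq := h3 q
  simp only [if_true, if_neg h1, if_neg h1.symm] at hm hq
  rcases h4 with ⟨ha, hm', he'⟩ | ⟨ha, hm', he'⟩
  · refine ⟨s.m, ⟨?_, ⟨-j, ?_⟩, ?_⟩, Or.inl ⟨?_, ?_, ?_⟩⟩
    · simpa [LS.R, hm'] using h1.symm
    · simp only [LS.R, hm', he', Bool.not_not]; rw [hm, hq, hj]; ring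
    · intro a
      simp only [LS.R, hm', he', Bool.not_not]; rw [h3 a]; ring
    · simpa [LS.R, hm'] using ha.symm
    · simp [LS.R]
    · simp [LS.R, he']
  · refine ⟨q, ⟨?_, ⟨j, ?_⟩, ?_⟩, Or.inr ⟨?_, ?_, ?_⟩⟩
    · simpa [LS.R, hm'] using h1
    · simp only [LS.R, hm', he', sg_not]; rw [hm, hq, hj]; ring
    · intro a
      simp only [LS.R, hm', he', sg_not]; rw [h3 a]; ring
    · simpa [LS.R, hm'] using ha
    · simp [LS.R, hm']
    · simp [LS.R, he']

lemma Step.det {V : Type*} {G : SimpleGraph V} {n : ℕ} {s s' s'' : LS V} {q r : V}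
    (hg : Good n s.x) (h : Step G n s s' q) (h' : Step G n s s'' r) : s' = s'' := by
  obtain ⟨⟨h1, ⟨j, hj⟩, h3⟩, h4⟩ := h
  obtain ⟨⟨k1, ⟨i, hi⟩, k3⟩, k4⟩ := h'
  have : q = r := hg _ _ ⟨j - i, by rw [hj, hi]; ring⟩
  subst this
  obtain ⟨x', m', e'⟩ := s'
  obtain ⟨x'', m'', e''⟩ := s''
  have hx : x' = x'' := by
    funext a
    exact (h3 a).trans (k3 a).symm
  subst hx
  simp only at h4 k4
  rcases h4 with ⟨ha, hm', he'⟩ | ⟨ha, hm', he'⟩ <;> rcases k4 with ⟨hb, hm'', he''⟩ | ⟨hb, hm'', he''⟩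
  · simp [hm', hm'', he', he'']
  · exact absurd ha hb
  · exact absurd hb ha
  · simp [hm', hm'', he', he'']

lemma fl_add {n : ℕ} (hn : 2 ≤ n) {d : ℤ} (h : ¬ (n : ℤ) ∣ d + 1) : (d + 1) / (n : ℤ) = d / n := by
  have hn0 : (0 : ℤ) < n := by omega
  have h1 := Int.emod_add_mul_ediv d n
  have h2 := Int.emod_nonneg d hn0.ne'
  have h3 := Int.emod_lt_of_pos d hn0
  have h4 : d % n + 1 ≠ n := by
    intro h5
    exact h ⟨d / n + 1, by linear_combination -h1 + h5⟩
  rw [Int.ediv_eq_iff_of_pos hn0]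
  constructor <;> nlinarith [lt_of_le_of_ne (Int.add_one_le_iff.2 h3) h4]

lemma fl_sg {n : ℕ} (hn : 2 ≤ n) {d : ℤ} (e : Bool) (h : ¬ (n : ℤ) ∣ d)
    (h' : ¬ (n : ℤ) ∣ d + sg e) : (d + sg e) / (n : ℤ) = d / n := by
  cases e
  · have := fl_add hn (d := d - 1) (by simpa using h)
    simp only [sg] at *
    simp at this
    rw [this]; rfl
  · exact fl_add hn (by simpa [sg] using h')

lemma fl_one {n : ℕ} (hn : 2 ≤ n) (j : ℤ) : (1 + n * j) / (n : ℤ) = j := by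
  have hn0 : (0 : ℤ) < n := by omega
  rw [Int.add_mul_ediv_left _ _ hn0.ne', Int.ediv_eq_zero_of_lt (by omega) (by omega)]; simp

lemma fl_neg_one {n : ℕ} (hn : 2 ≤ n) (j : ℤ) : (-1 + n * j) / (n : ℤ) = j - 1 := by
  have hn0 : (0 : ℤ) < n := by omega
  rw [Int.add_mul_ediv_left _ _ hn0.ne']
  have : (-1 : ℤ) / n = -1 := by
    rw [Int.ediv_eq_iff_of_pos hn0]; omega
  rw [this]; ring

lemma fl_neg {n : ℕ} (hn : 2 ≤ n) {d : ℤ} (h : ¬ (n : ℤ) ∣ d) : (-d) / (n : ℤ) = - (d / n) - 1 := by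
  have hn0 : (0 : ℤ) < n := by omega
  have h1 := Int.emod_add_mul_ediv d n
  have h2 := Int.emod_nonneg d hn0.ne'
  have h3 := Int.emod_lt_of_pos d hn0
  have h4 : d % n ≠ 0 := fun h5 => h (Int.dvd_of_emod_eq_zero h5)
  rw [Int.ediv_eq_iff_of_pos hn0]
  constructor
  · nlinarith
  · have : 0 < d % n := by omega
    nlinarith

/-- change of the floor of differences under a step -/
lemma PStep.floor {V : Type*} {n : ℕ} (hn : 2 ≤ n) {s s' : LS V} {q : V} (hg : Good n s.x)
    (hg' : Good n s'.x) (h : PStep n s s' q) (a b : V) :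
    (s'.x a - s'.x b) / (n : ℤ) = (s.x a - s.x b) / n +
      sg s.e * ((if a = s.m ∧ b = q then 1 else 0) - (if a = q ∧ b = s.m then 1 else 0)) := by
  obtain ⟨h1, ⟨j, hj⟩, h3⟩ := h
  by_cases hab : a = b
  · subst hab
    have h6 : ¬ (a = s.m ∧ a = q) := fun h => h1 (h.2.symm.trans h.1)
    have h7 : ¬ (a = q ∧ a = s.m) := fun h => h1 (h.1.symm.trans h.2)
    simp [h6, h7]
  have n1 : ¬ (n : ℤ) ∣ s.x a - s.x b := fun h => hab (hg _ _ h)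
  have n2 : ¬ (n : ℤ) ∣ s'.x a - s'.x b := fun h => hab (hg' _ _ h)
  have key : ∀ e, s'.x a - s'.x b = s.x a - s.x b + sg e →
      ((if a = s.m ∧ b = q then 1 else 0) - (if a = q ∧ b = s.m then 1 else 0) : ℤ) = 0 →
      (s'.x a - s'.x b) / (n : ℤ) = (s.x a - s.x b) / n +
      sg s.e * ((if a = s.m ∧ b = q then 1 else 0) - (if a = q ∧ b = s.m then 1 else 0)) := by
    intro e he h0
    rw [h0]
    rw [he] at n2 ⊢
    rw [fl_sg hn e n1 n2]; ring
  have ha := h3 a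
  have hb := h3 b
  by_cases ham : a = s.m
  · have haq : a ≠ q := fun h => h1 (h.symm.trans ham)
    have hbm : b ≠ s.m := fun h => hab (ham.trans h.symm)
    rw [if_pos ham, if_neg haq] at ha
    rw [if_neg hbm] at hb
    by_cases hbq : b = q
    · rw [if_pos hbq] at hb
      rw [if_pos ⟨ham, hbq⟩, if_neg (fun h => haq h.1)]
      have e1 := fl_one hn (-j)
      have e2 := fl_neg_one hn (-j)
      have d1 : s.x a - s.x b = - sg s.e + n * (-j) := by rw [ham, hbq, hj]; ring
      have d2 : s'.x a - s'.x b = sg s.e + n * (-j) := by rw [ha, hb]; linear_combination d1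
      rw [d1, d2]
      cases s.e
      · simp only [sg, Bool.false_eq_true, if_false, neg_neg, e1, e2]; ring
      · simp only [sg, if_true, e1, e2]; ring
    · rw [if_neg hbq] at hb
      exact key s.e (by rw [ha, hb]; ring) (by simp [hbq, haq])
  · rw [if_neg ham] at ha
    by_cases haq : a = q
    · have hbq : b ≠ q := fun h => hab (haq.trans h.symm)
      rw [if_pos haq] at ha
      rw [if_neg hbq] at hb
      by_cases hbm : b = s.m
      · rw [if_pos hbm] at hb
        rw [if_neg (fun h => ham h.1), if_pos ⟨haq, hbm⟩]
        have e1 := fl_one hn j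
        have e2 := fl_neg_one hn j
        have d1 : s.x a - s.x b = sg s.e + n * j := by rw [haq, hbm, hj]; ring
        have d2 : s'.x a - s'.x b = - sg s.e + n * j := by rw [ha, hb]; linear_combination d1
        rw [d1, d2]
        cases s.e
        · simp only [sg, Bool.false_eq_true, if_false, neg_neg, e1, e2]; ring
        · simp only [sg, if_true, e1, e2]; ring
      · rw [if_neg hbm] at hb
        exact key (!s.e) (by rw [ha, hb, sg_not]; ring) (by simp [hbm, ham])
    · rw [if_neg haq] at ha
      by_cases hbm : b = s.m
      · have hbq : b ≠ q := fun h => h1 (h.symm.trans hbm)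
        rw [if_pos hbm, if_neg hbq] at hb
        exact key (!s.e) (by rw [ha, hb, sg_not]; ring) (by simp [haq, ham])
      · rw [if_neg hbm] at hb
        by_cases hbq : b = q
        · rw [if_pos hbq] at hb
          exact key s.e (by rw [ha, hb]; ring) (by simp [haq, ham])
        · rw [if_neg hbq] at hb
          rw [if_neg (fun h => ham h.1), if_neg (fun h => haq h.1), ha, hb]
          simp

lemma adj_floor {V : Type*} {n : ℕ} (hn : 2 ≤ n) {x : V → ℤ} {m q : V} {e : Bool} (hg : Good n x)
    {j : ℤ} (hj : x q = x m + sg e + n * j) :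
    (x q - x m) / (n : ℤ) = j - (if e then 0 else 1) ∧
    ∀ c, c ≠ m → c ≠ q → (x c - x q) / (n : ℤ) = (x c - x m) / n - j := by
  have hn0 : (0 : ℤ) < n := by omega
  constructor
  · rw [hj]
    cases e
    · have := fl_neg_one hn j
      simp only [sg]; simp
      rw [← this]; ring_nf
    · have := fl_one hn j
      simp only [sg]; simp
      rw [← this]; ring_nf; simp [this]
  · intro c hcm hcq
    have n1 : ¬ (n : ℤ) ∣ x c - x m := fun h => hcm (hg _ _ h)
    have n2 : ¬ (n : ℤ) ∣ x c - x q := fun h => hcq (hg _ _ h)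
    have n3 : ¬ (n : ℤ) ∣ x c - x m + sg (!e) := by
      rintro ⟨i, hi⟩
      rw [sg_not] at hi
      exact n2 ⟨i - j, by rw [hj]; linear_combination hi⟩
    have := fl_sg hn (!e) n1 n3
    rw [← this]
    have e2 : x c - x q = (x c - x m + sg (!e)) + n * (-j) := by rw [hj, sg_not]; ring
    rw [e2, Int.add_mul_ediv_left _ _ hn0.ne']; ring

def FRel {U V : Type*} (f : U → V) (n k : ℕ) (x : V → ℤ) (y : U → ℤ) : Prop :=
  ∀ a b, (x (f a) - x (f b)) / (n : ℤ) = (y a - y b) / (k : ℤ)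

lemma next_eq {U V : Type*} {f : U → V} (hf : Function.Injective f) {n k : ℕ} (hn : 2 ≤ n)
    (hk : 2 ≤ k) {x : V → ℤ} {y : U → ℤ} (hx : Good n x) (hy : Good k y) (hr : FRel f n k x y)
    {e : Bool} {m q r : U} (hqm : q ≠ m) (hrm : r ≠ m) {i j : ℤ}
    (hi : x (f r) = x (f m) + sg e + n * i) (hj : y q = y m + sg e + k * j) : q = r := by
  by_contra hqr
  obtain ⟨a1, a2⟩ := adj_floor hn hx hi
  obtain ⟨b1, b2⟩ := adj_floor hk hy hj
  have a3 := a2 (f q) (fun h => hqm (hf h)) (fun h => hqr (hf h))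
  have b3 := b2 r hrm (fun h => hqr h.symm)
  rw [hr] at a1
  rw [hr, hr] at a3
  have := fl_neg hk (d := y q - y r) (fun h => hqr (hy _ _ h))
  rw [neg_sub] at this
  split_ifs at a1 b1 <;> omega

/-- the invariant -/
def FInv {U V : Type*} (f : U → V) (v : U) (n k : ℕ) (S : LS V) (T : LS U) : Prop :=
  FRel f n k S.x T.x ∧ ((S.m = f T.m ∧ S.e = T.e) ∨ (S.m ∉ Set.range f ∧ T.m = v))

lemma inv_step {U V : Type*} {f : U → V} (hf : Function.Injective f) {v : U} {n k : ℕ}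
    (hn : 2 ≤ n) (hk : 2 ≤ k) {G : SimpleGraph V} {H : SimpleGraph U}
    (hGH : ∀ a b, G.Adj (f a) (f b) ↔ H.Adj a b)
    (hcut : ∀ a z, z ∉ Set.range f → G.Adj (f a) z → a = v)
    {S S' : LS V} {q : V} (hS : Good n S.x) (hS' : Good n S'.x) (hst : Step G n S S' q)
    (B : Set (LS U)) (hB : ∀ T ∈ B, Good k T.x) (hBR : ∀ T ∈ B, T.R ∈ B)
    (hBs : ∀ T ∈ B, ∃ T' ∈ B, ∃ r, Step H k T T' r) {T : LS U} (hT : T ∈ B)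
    (hI : FInv f v n k S T) : ∃ T' ∈ B, FInv f v n k S' T' := by
  obtain ⟨hps, hadj⟩ := hst
  have hfl := hps.floor hn hS hS'
  obtain ⟨hrel, hm⟩ := hI
  have hrel0 : (¬ (S.m ∈ Set.range f ∧ q ∈ Set.range f)) → FRel f n k S'.x T.x := by
    intro h a b
    rw [hfl, ← hrel a b]
    rw [if_neg, if_neg]
    · ring
    · rintro ⟨h1, h2⟩; exact h ⟨⟨_, h2⟩, ⟨_, h1⟩⟩
    · rintro ⟨h1, h2⟩; exact h ⟨⟨_, h1⟩, ⟨_, h2⟩⟩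
  by_cases hq : q ∈ Set.range f
  · obtain ⟨r, rfl⟩ := hq
    rcases hm with ⟨hm, he⟩ | ⟨hm, hv⟩
    · obtain ⟨T', hT', p, hTp⟩ := hBs T hT
      obtain ⟨hpT, hadjT⟩ := hTp
      have hpr : p = r := by
        obtain ⟨h1, ⟨i, hi⟩, h3⟩ := hps
        obtain ⟨k1, ⟨j, hj⟩, k3⟩ := hpT
        rw [hm, he] at hi
        rw [hm] at h1
        exact next_eq hf hn hk hS (hB T hT) hrel k1 (fun h => h1 (by rw [h])) hi hj
      subst hpr
      refine ⟨T', hT', ?_, ?_⟩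
      · intro a b
        rw [hfl, hpT.floor hk (hB T hT) (hB T' hT'), hrel a b, hm, he]
        simp only [hf.eq_iff]
      · left
        rw [hm, hGH] at hadj
        rcases hadj with ⟨ha, hm', he'⟩ | ⟨ha, hm', he'⟩ <;> rcases hadjT with ⟨hb, hm'', he''⟩ | ⟨hb, hm'', he''⟩
        · rw [hm', hm'', he', he'', he]; simp
        · exact absurd ha hb
        · exact absurd hb ha
        · rw [hm', hm'', he', he'', he]; simp
    · have hr := hrel0 (fun h => hm h.1)
      rcases hadj with ⟨ha, hm', he'⟩ | ⟨ha, hm', he'⟩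
      · have : r = v := hcut _ _ hm ha.symm
        by_cases he : S'.e = T.e
        · exact ⟨T, hT, hr, Or.inl ⟨by rw [hm', this, hv], he⟩⟩
        · refine ⟨T.R, hBR _ hT, hr, Or.inl ⟨by simp only [LS.R]; rw [hm', this, hv], ?_⟩⟩
          simp only [LS.R]
          revert he
          cases S'.e <;> cases T.e <;> simp
      · exact ⟨T, hT, hr, Or.inr ⟨by rw [hm']; exact hm, hv⟩⟩
  · have hr := hrel0 (fun h => hq h.2)
    refine ⟨T, hT, hr, ?_⟩
    rcases hadj with ⟨ha, hm', he'⟩ | ⟨ha, hm', he'⟩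
    · right
      refine ⟨by rw [hm']; exact hq, ?_⟩
      rcases hm with ⟨hm, he⟩ | ⟨hm, hv⟩
      · rw [hm] at ha
        exact hcut _ _ hq ha
      · exact hv
    · rw [hm', he']; exact hm

noncomputable def mover {V : Type*} [Fintype V] (D : Xi V) : V :=
  D.1.symm (D.2.1 + if D.2.2 then 0 else 1)

def Lifts {V : Type*} [Fintype V] (D : Xi V) (x : V → ℤ) : Prop :=
  ∀ a, (x a : ZMod (Fintype.card V)) = D.1 a

lemma Lifts.good {V : Type*} [Fintype V] {D : Xi V} {x : V → ℤ} (h : Lifts D x) :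
    Good (Fintype.card V) x := by
  intro a b hab
  apply D.1.injective
  rw [← h a, ← h b]
  exact ((ZMod.intCast_eq_intCast_iff_dvd_sub _ _ _).2 hab).symm

lemma disp_cast {V : Type*} [Fintype V] (hn : 2 ≤ Fintype.card V) (G : SimpleGraph V) (D : Xi V)
    (a : V) : D.1 a + ((disp D a : ℤ) : ZMod (Fintype.card V)) = (theta G D).1 a := by
  have h : (theta G D).1 a = Equiv.swap D.2.1 (D.2.1 + 1) (D.1 a) := by
    unfold theta; split_ifs <;> rfl
  rw [h, disp]
  split_ifs with h1 h2
  · rw [h1]; simp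
  · rw [h2]; simp
  · rw [Equiv.swap_apply_of_ne_of_ne h1 h2]; simp

lemma Lifts.next {V : Type*} [Fintype V] (hn : 2 ≤ Fintype.card V) (G : SimpleGraph V) {D : Xi V}
    {x : V → ℤ} (h : Lifts D x) : Lifts (theta G D) (fun a => x a + disp D a) := by
  intro a
  rw [← disp_cast hn]
  push_cast
  rw [h a]

lemma Lifts.prev {V : Type*} [Fintype V] (hn : 2 ≤ Fintype.card V) (G : SimpleGraph V) {D : Xi V}
    {x : V → ℤ} (h : Lifts (theta G D) x) : Lifts D (fun a => x a - disp D a) := by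
  intro a
  push_cast
  rw [h a, ← disp_cast hn]
  ring

lemma Lifts.step {V : Type*} [Fintype V] (hn : 2 ≤ Fintype.card V) (G : SimpleGraph V) {D : Xi V}
    {x x' : V → ℤ} (h : Lifts D x) (hx' : ∀ a, x' a = x a + disp D a) :
    ∃ q, Step G (Fintype.card V) ⟨x, mover D, D.2.2⟩
      ⟨x', mover (theta G D), (theta G D).2.2⟩ q := by
  have : Fact (1 < Fintype.card V) := ⟨hn⟩
  obtain ⟨w, i, e⟩ := D
  have hne : i ≠ i + 1 := by simp
  have hdiv : ∀ a b : V, ∀ c : ℤ, w b = w a + c → ∃ j : ℤ, x b = x a + c + Fintype.card V * j := by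
    intro a b c hab
    have h1 := h a
    have h2 := h b
    simp only at h1 h2
    rw [← h1, ← h2] at hab
    have h3 : ((x a + c : ℤ) : ZMod (Fintype.card V)) = (x b : ℤ) := by push_cast; exact hab.symm
    obtain ⟨j, hj⟩ := (ZMod.intCast_eq_intCast_iff_dvd_sub _ _ _).1 h3
    exact ⟨j, by linear_combination hj⟩
  have hw : ∀ (a : V) j, (a = w.symm j) = (w a = j) := by
    intro a j; rw [Equiv.eq_symm_apply]
  cases e
  · refine ⟨w.symm i, ⟨?_, ?_, ?_⟩, ?_⟩
    · simp [mover]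
    · apply hdiv; simp [mover, sg]
    · intro a
      simp only [hx', disp, mover, sg, hw, Bool.false_eq_true, if_false]
      split_ifs with h1 h2 h2 <;> first | exact absurd (h1.symm.trans h2) hne | exact absurd (h2.symm.trans h1) hne | ring
    · by_cases hadj : G.Adj (w.symm i) (w.symm (i+1))
      · left
        simp [mover, theta, hadj, hadj.symm, epsZ, Equiv.symm_trans_apply]
      · right
        have hadj' : ¬ G.Adj (w.symm (i+1)) (w.symm i) := fun h => hadj h.symm
        simp [mover, theta, hadj, hadj', epsZ, Equiv.symm_trans_apply]
  · refine ⟨w.symm (i+1), ⟨?_, ?_, ?_⟩, ?_⟩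
    · simp [mover]
    · apply hdiv; simp [mover, sg]
    · intro a
      simp only [hx', disp, mover, sg, hw, if_true, add_zero]
      split_ifs with h1 h2 h2 <;> first | exact absurd (h1.symm.trans h2) hne | exact absurd (h2.symm.trans h1) hne | ring
    · by_cases hadj : G.Adj (w.symm i) (w.symm (i+1))
      · left
        simp [mover, theta, hadj, epsZ, Equiv.symm_trans_apply]
      · right
        simp [mover, theta, hadj, epsZ, Equiv.symm_trans_apply]

lemma exists_lift {V : Type*} [Fintype V] (D : Xi V) : ∃ x, Lifts D x := by
  refine ⟨fun a => (D.1 a).cast, fun a => ?_⟩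
  simp

lemma Lifts.ext {V : Type*} [Fintype V] {D D' : Xi V} {x : V → ℤ} (h : Lifts D x) (h' : Lifts D' x)
    (hm : mover D = mover D') (he : D.2.2 = D'.2.2) : D = D' := by
  obtain ⟨w, i, e⟩ := D
  obtain ⟨w', i', e'⟩ := D'
  have : w = w' := by
    ext a
    exact (h a).symm.trans (h' a)
  subst this
  simp only at he
  subst he
  simp only [mover, EmbeddingLike.apply_eq_iff_eq, add_left_inj] at hm
  rw [hm]

lemma Step.back {V : Type*} {G : SimpleGraph V} {n : ℕ} {s s' s'' : LS V} {q r : V}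
    (hg : Good n s''.x) (h : Step G n s s'' q) (h' : Step G n s' s'' r) : s = s' := by
  obtain ⟨p, hp⟩ := h.rev
  obtain ⟨t, ht⟩ := h'.rev
  have := Step.det (s := s''.R) hg hp ht
  rw [← s.R_R, this, s'.R_R]

lemma theta_inj {V : Type*} [Fintype V] (hn : 2 ≤ Fintype.card V) (G : SimpleGraph V) :
    Function.Injective (theta G) := by
  intro D D' hD
  obtain ⟨x, hx⟩ := exists_lift (theta G D)
  have h1 := hx.prev hn
  have h2 := (hD ▸ hx).prev hn
  obtain ⟨q, hq⟩ := h1.step (x' := x) hn G (fun a => by simp)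
  obtain ⟨r, hr⟩ := h2.step (x' := x) hn G (fun a => by simp)
  rw [← hD] at hr
  have := Step.back hx.good hq hr
  rw [LS.mk.injEq] at this
  refine Lifts.ext h1 ?_ this.2.1 this.2.2
  rw [this.1]; exact h2

noncomputable def lseq {V : Type*} [Fintype V] (G : SimpleGraph V) (D : Xi V) (x : V → ℤ) (j : ℕ) :
    LS V :=
  ⟨fun a => x a + ∑ k ∈ Finset.range j, disp ((theta G)^[k] D) a, mover ((theta G)^[j] D),
    ((theta G)^[j] D).2.2⟩

lemma lseq_lifts {V : Type*} [Fintype V] (hn : 2 ≤ Fintype.card V) (G : SimpleGraph V) {D : Xi V}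
    {x : V → ℤ} (h : Lifts D x) (j : ℕ) : Lifts ((theta G)^[j] D) (lseq G D x j).x := by
  induction j with
  | zero => simpa [lseq] using h
  | succ j ih =>
    have := ih.next hn G
    rw [Function.iterate_succ_apply']
    convert this using 2 with a
    simp only [lseq, Finset.sum_range_succ]; ring

lemma lseq_step {V : Type*} [Fintype V] (hn : 2 ≤ Fintype.card V) (G : SimpleGraph V) {D : Xi V}
    {x : V → ℤ} (h : Lifts D x) (j : ℕ) :
    ∃ q, Step G (Fintype.card V) (lseq G D x j) (lseq G D x (j+1)) q := by
  have := (lseq_lifts hn G h j).step (x' := (lseq G D x (j+1)).x) hn G (fun a => by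
    simp only [lseq, Finset.sum_range_succ]; ring)
  rw [← Function.iterate_succ_apply' (theta G)] at this
  exact this

lemma sum_period {V : Type*} [Fintype V] (G : SimpleGraph V) (D : Xi V) (a : V) (j : ℕ) :
    ∑ k ∈ Finset.range (Function.minimalPeriod (theta G) D + j), disp ((theta G)^[k] D) a =
      windSum G D a + ∑ k ∈ Finset.range j, disp ((theta G)^[k] D) a := by
  rw [Finset.sum_range_add, windSum]
  congr 1
  apply Finset.sum_congr rfl
  intro k _
  rw [add_comm, Function.iterate_add_apply, Function.iterate_minimalPeriod]

lemma sum_period_mul {V : Type*} [Fintype V] (G : SimpleGraph V) (D : Xi V) (a : V) (N : ℕ) :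
    ∑ k ∈ Finset.range (Function.minimalPeriod (theta G) D * N), disp ((theta G)^[k] D) a =
      N * windSum G D a := by
  induction N with
  | zero => simp
  | succ N ih =>
    rw [Nat.mul_succ, add_comm, sum_period, ih]; push_cast; ring

lemma sum_disp {V : Type*} [Fintype V] (hn : 2 ≤ Fintype.card V) (D : Xi V) :
    ∑ a, disp D a = 0 := by
  have : Fact (1 < Fintype.card V) := ⟨hn⟩
  have : NeZero (Fintype.card V) := ⟨by omega⟩
  have hne : D.2.1 + 1 ≠ D.2.1 := by simp
  have : ∀ a, disp D a = (fun z => (if z = D.2.1 then (1:ℤ) else 0) - (if z = D.2.1 + 1 then 1 else 0)) (D.1 a) := by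
    intro a
    simp only [disp]
    split_ifs with h1 h2 h2
    · exact absurd (h2.symm.trans h1) hne
    all_goals simp
  rw [Finset.sum_congr rfl (fun a _ => this a)]
  rw [Equiv.sum_comp D.1 (fun z => (if z = D.2.1 then (1:ℤ) else 0) - (if z = D.2.1 + 1 then 1 else 0))]
  simp

lemma lseq_periodic {V : Type*} [Fintype V] (G : SimpleGraph V) (D : Xi V) (x : V → ℤ)
    (h : WindingVectorZero G D) (j : ℕ) :
    lseq G D x (Function.minimalPeriod (theta G) D + j) = lseq G D x j := by
  have e : (theta G)^[Function.minimalPeriod (theta G) D + j] D = (theta G)^[j] D := by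
    rw [add_comm, Function.iterate_add_apply, Function.iterate_minimalPeriod]
  simp only [lseq, e, sum_period, h _, zero_add]

lemma period_pos {V : Type*} [Fintype V] (hn : 2 ≤ Fintype.card V) (G : SimpleGraph V) (D : Xi V) :
    0 < Function.minimalPeriod (theta G) D := by
  have : NeZero (Fintype.card V) := ⟨by omega⟩
  exact Function.minimalPeriod_pos_of_mem_periodicPts ((theta_inj hn G).mem_periodicPts D)

lemma lseq_bounded {V : Type*} [Fintype V] (hn : 2 ≤ Fintype.card V) (G : SimpleGraph V) (D : Xi V)
    (x : V → ℤ) (h : WindingVectorZero G D) : ∃ M : ℤ, ∀ j a, |(lseq G D x j).x a| ≤ M := by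
  have hP := period_pos hn G D
  set P := Function.minimalPeriod (theta G) D with hPd
  refine ⟨∑ j ∈ Finset.range P, ∑ a, |(lseq G D x j).x a|, ?_⟩
  intro j
  induction j using Nat.strong_induction_on with
  | _ j ih =>
    intro a
    by_cases hj : j < P
    · refine le_trans ?_ (Finset.single_le_sum (f := fun j => ∑ a, |(lseq G D x j).x a|)
        (fun i _ => Finset.sum_nonneg (fun a _ => abs_nonneg _)) (Finset.mem_range.2 hj))
      exact Finset.single_le_sum (f := fun a => |(lseq G D x j).x a|)
        (fun a _ => abs_nonneg _) (Finset.mem_univ a)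
    · obtain ⟨i, rfl⟩ := Nat.exists_eq_add_of_le (not_lt.1 hj)
      rw [hPd, lseq_periodic G D x h]
      exact ih i (by omega) a

/-- initial flattening -/
lemma exists_flat {U : Type*} [Fintype U] [Nonempty U] (n : ℕ) (x : U → ℤ)
    (hinj : Function.Injective x) (h0 : ∀ a, 0 ≤ x a) (h1 : ∀ a, x a < n) :
    ∃ (E : U ≃ ZMod (Fintype.card U)) (y : U → ℤ),
      (∀ a, (y a : ZMod (Fintype.card U)) = E a) ∧
      ∀ a b, (x a - x b) / (n : ℤ) = (y a - y b) / (Fintype.card U : ℤ) := by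
  have : NeZero (Fintype.card U) := ⟨Fintype.card_ne_zero⟩
  let r : U → ℕ := fun a => (Finset.univ.filter (fun b => x b < x a)).card
  have hr : ∀ a, r a < Fintype.card U := by
    intro a
    apply Finset.card_lt_univ_of_notMem (x := a)
    simp
  have hle : ∀ a b, x a ≤ x b → r a ≤ r b := by
    intro a b hab
    apply Finset.card_le_card
    intro c
    simp only [Finset.mem_filter, Finset.mem_univ, true_and]
    intro h; omega
  have hlt : ∀ a b, x a < x b → r a < r b := by
    intro a b hab
    apply Finset.card_lt_card
    refine (Finset.ssubset_iff_of_subset ?_).2 ⟨a, by simpa using hab, by simp⟩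
    intro c
    simp only [Finset.mem_filter, Finset.mem_univ, true_and]
    intro h; omega
  have hi : Function.Injective (fun a => (r a : ZMod (Fintype.card U))) := by
    intro a b hab
    simp only at hab
    rw [ZMod.natCast_eq_natCast_iff'] at hab
    rw [Nat.mod_eq_of_lt (hr a), Nat.mod_eq_of_lt (hr b)] at hab
    apply hinj
    rcases lt_trichotomy (x a) (x b) with h | h | h
    · have := hlt _ _ h; omega
    · exact h
    · have := hlt _ _ h; omega
  have hb : Function.Bijective (fun a => (r a : ZMod (Fintype.card U))) := by
    rw [Fintype.bijective_iff_injective_and_card]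
    exact ⟨hi, by simp [ZMod.card]⟩
  refine ⟨Equiv.ofBijective _ hb, fun a => r a, fun a => by simp, ?_⟩
  intro a b
  have g0 := h0 a
  have g1 := h0 b
  have g2 := h1 a
  have g3 := h1 b
  have g4 := hr a
  have g5 := hr b
  simp only
  rcases lt_or_ge (x a) (x b) with h | h
  · have h2 := hlt _ _ h
    have k1 : (x a - x b) / (n : ℤ) = -1 := by
      rw [Int.ediv_eq_iff_of_pos (by omega)]; omega
    have k2 : ((r a : ℤ) - r b) / (Fintype.card U : ℤ) = -1 := by
      rw [Int.ediv_eq_iff_of_pos (by omega)]; omega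
    rw [k1, k2]
  · have h2 := hle _ _ h
    rw [Int.ediv_eq_zero_of_lt (by omega) (by omega), Int.ediv_eq_zero_of_lt (by omega) (by omega)]

lemma wind_eq {U V : Type*} [Fintype U] [Fintype V] {f : U → V} (hf : Function.Injective f) (v : U)
    (hn : 2 ≤ Fintype.card V) (hk : 2 ≤ Fintype.card U) {G : SimpleGraph V} {H : SimpleGraph U}
    (hGH : ∀ a b, G.Adj (f a) (f b) ↔ H.Adj a b)
    (hcut : ∀ a z, z ∉ Set.range f → G.Adj (f a) z → a = v)
    (hH : ∀ E : Xi U, WindingVectorZero H E) (D : Xi V) (a b : U) :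
    windSum G D (f a) = windSum G D (f b) := by
  have : NeZero (Fintype.card V) := ⟨by omega⟩
  have : Nonempty U := ⟨v⟩
  set n := Fintype.card V with hnd
  set k := Fintype.card U with hkd
  let x0 : V → ℤ := fun a => ((D.1 a).val : ℤ)
  have hx0 : Lifts D x0 := by
    intro a
    simp only [x0]
    rw [Int.cast_natCast]; exact ZMod.natCast_zmod_val _
  obtain ⟨E, y0, hy0, hfl⟩ := exists_flat n (fun u => x0 (f u))
    (fun c d hcd => hf (D.1.injective (ZMod.val_injective _ (Int.ofNat.inj hcd))))
    (fun c => Int.natCast_nonneg _) (fun c => Int.ofNat_lt.2 (ZMod.val_lt _))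
  -- initial state downstairs
  let m0 : U := if h : ∃ u, mover D = f u then h.choose else v
  let D0 : Xi U := (E, E m0 - (if D.2.2 then 0 else 1), D.2.2)
  have hm0 : mover D0 = m0 := by simp [mover, D0]
  have hL0 : Lifts D0 y0 := hy0
  obtain ⟨M, hM⟩ := lseq_bounded hk H D0 y0 (hH D0)
  have hP := period_pos hk H D0
  let B : Set (LS U) := {T | ∃ j, T = lseq H D0 y0 j ∨ T.R = lseq H D0 y0 j}
  have hgood : ∀ j, Good k (lseq H D0 y0 j).x := fun j => (lseq_lifts hk H hL0 j).good
  have hB : ∀ T ∈ B, Good k T.x := by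
    rintro T ⟨j, rfl | hj⟩
    · exact hgood j
    · have := hgood j
      rw [← hj] at this; exact this
  have hBR : ∀ T ∈ B, T.R ∈ B := by
    rintro T ⟨j, hj | hj⟩
    · exact ⟨j, Or.inr (by rw [LS.R_R, hj])⟩
    · exact ⟨j, Or.inl hj⟩
  have hBM : ∀ T ∈ B, ∀ u, |T.x u| ≤ M := by
    rintro T ⟨j, rfl | hj⟩ u
    · exact hM j u
    · have := hM j u
      rw [← hj] at this; exact this
  have hBs : ∀ T ∈ B, ∃ T' ∈ B, ∃ r, Step H k T T' r := by
    rintro T ⟨j, rfl | hj⟩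
    · exact ⟨_, ⟨j + 1, Or.inl rfl⟩, lseq_step hk H hL0 j⟩
    · obtain ⟨i, hi⟩ : ∃ i, Function.minimalPeriod (theta H) D0 + j = i + 1 :=
        ⟨Function.minimalPeriod (theta H) D0 + j - 1, by omega⟩
      have h1 := lseq_periodic H D0 y0 (hH D0) j
      rw [hi, ← hj] at h1
      obtain ⟨q, hq⟩ := lseq_step hk H hL0 i
      rw [h1] at hq
      obtain ⟨r, hr⟩ := hq.rev
      rw [LS.R_R] at hr
      exact ⟨_, ⟨i, Or.inr (LS.R_R _)⟩, r, hr⟩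
  have hinv : ∀ t, ∃ T ∈ B, FInv f v n k (lseq G D x0 t) T := by
    intro t
    induction t with
    | zero =>
      refine ⟨_, ⟨0, Or.inl rfl⟩, ?_, ?_⟩
      · intro c d
        simpa [lseq] using hfl c d
      · simp only [lseq, Function.iterate_zero, id_eq, hm0]
        by_cases h : ∃ u, mover D = f u
        · left
          simp only [m0, dif_pos h]
          exact ⟨h.choose_spec, rfl⟩
        · right
          simp only [m0, dif_neg h, and_true]
          rintro ⟨u, hu⟩
          exact h ⟨u, hu.symm⟩
    | succ t ih =>
      obtain ⟨T, hT, hI⟩ := ih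
      obtain ⟨q, hq⟩ := lseq_step hn G hx0 t
      exact inv_step hf hn hk hGH hcut (lseq_lifts hn G hx0 t).good (lseq_lifts hn G hx0 (t+1)).good
        hq B hB hBR hBs hT hI
  by_contra hne
  set Wd := windSum G D (f a) - windSum G D (f b) with hWd
  have hWd0 : Wd ≠ 0 := sub_ne_zero.2 hne
  set x1 := x0 (f a) - x0 (f b) with hx1
  have hM0 : 0 ≤ M := (abs_nonneg _).trans (hM 0 a)
  have hbound : ∀ N : ℕ, |(N : ℤ) * Wd + x1| ≤ n * (2 * M + 1) := by
    intro N
    obtain ⟨T, hT, hI, -⟩ := hinv (Function.minimalPeriod (theta G) D * N)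
    have h1 := hI a b
    simp only [lseq, sum_period_mul] at h1
    have h2 : x0 (f a) + (N : ℤ) * windSum G D (f a) - (x0 (f b) + (N : ℤ) * windSum G D (f b)) =
      (N : ℤ) * Wd + x1 := by rw [hWd, hx1]; ring
    rw [h2] at h1
    have h3 : |(T.x a - T.x b) / (k : ℤ)| ≤ 2 * M := by
      refine (Int.abs_ediv_le_abs _ _).trans ((abs_sub _ _).trans ?_)
      have := hBM T hT a
      have := hBM T hT b
      omega
    rw [← h1] at h3
    have hn0 : (0 : ℤ) < n := by omega
    have e1 := Int.emod_add_mul_ediv ((N : ℤ) * Wd + x1) n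
    have e2 := Int.emod_nonneg ((N : ℤ) * Wd + x1) hn0.ne'
    have e3 := Int.emod_lt_of_pos ((N : ℤ) * Wd + x1) hn0
    rw [abs_le] at h3 ⊢
    constructor <;> nlinarith
  set C : ℤ := n * (2 * M + 1) + |x1| with hC
  have hC0 : 0 ≤ C := by positivity
  have h1 := hbound (C.toNat + 1)
  have h2 : |((C.toNat + 1 : ℕ) : ℤ) * Wd| ≤ C := by
    have := abs_sub (((C.toNat + 1 : ℕ) : ℤ) * Wd + x1) x1
    rw [add_sub_cancel_right] at this
    omega
  have h3 : (((C.toNat + 1 : ℕ) : ℤ)) = C + 1 := by push_cast; rw [Int.toNat_of_nonneg hC0]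
  rw [h3, abs_mul, abs_of_pos (by omega : 0 < C + 1)] at h2
  have h4 : 1 ≤ |Wd| := Int.one_le_abs hWd0
  nlinarith

lemma wind_eq' {U V : Type*} [Fintype U] [Fintype V] {f : U → V} (hf : Function.Injective f) (v : U)
    (hn : 2 ≤ Fintype.card V) {G : SimpleGraph V} {H : SimpleGraph U}
    (hGH : ∀ a b, G.Adj (f a) (f b) ↔ H.Adj a b)
    (hcut : ∀ a z, z ∉ Set.range f → G.Adj (f a) z → a = v)
    (hH : Ensnaring H) (D : Xi V) (a b : U) :
    windSum G D (f a) = windSum G D (f b) := by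
  by_cases h1 : Fintype.card U = 1
  · have := Fintype.card_le_one_iff_subsingleton.1 h1.le
    rw [Subsingleton.elim a b]
  · have : Nonempty U := ⟨v⟩
    have := Fintype.card_pos (α := U)
    exact wind_eq hf v hn (by omega) hGH hcut (hH.resolve_left h1) D a b

lemma sum_wind {V : Type*} [Fintype V] (hn : 2 ≤ Fintype.card V) (G : SimpleGraph V) (D : Xi V) :
    ∑ a, windSum G D a = 0 := by
  simp only [windSum]
  rw [Finset.sum_comm]
  simp [sum_disp hn]

/-- If `G₁` and `G₂` are ensnaring graphs, then any wedge of `G₁` and `G₂`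
is ensnaring. -/
theorem stmt_6 {V₁ V₂ : Type*} [Fintype V₁] [Fintype V₂] [DecidableEq V₂]
    (G₁ : SimpleGraph V₁) (G₂ : SimpleGraph V₂) (v₁ : V₁) (v₂ : V₂)
    (h₁ : Ensnaring G₁) (h₂ : Ensnaring G₂) :
    Ensnaring (wedge G₁ G₂ v₁ v₂) := by
  by_cases hc : Fintype.card (V₁ ⊕ {y : V₂ // y ≠ v₂}) = 1
  · exact Or.inl hc
  right
  have : Nonempty (V₁ ⊕ {y : V₂ // y ≠ v₂}) := ⟨Sum.inl v₁⟩
  have hpos := Fintype.card_pos (α := V₁ ⊕ {y : V₂ // y ≠ v₂})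
  have hn : 2 ≤ Fintype.card (V₁ ⊕ {y : V₂ // y ≠ v₂}) := by omega
  intro D
  let f₂ : V₂ → V₁ ⊕ {y : V₂ // y ≠ v₂} := fun y => if h : y = v₂ then Sum.inl v₁ else Sum.inr ⟨y, h⟩
  have f₂v : f₂ v₂ = Sum.inl v₁ := by simp [f₂]
  have f₂n : ∀ y (h : y ≠ v₂), f₂ y = Sum.inr ⟨y, h⟩ := fun y h => by simp [f₂, h]
  have hf₂ : Function.Injective f₂ := by
    intro a b hab
    by_cases ha : a = v₂ <;> by_cases hb : b = v₂
    · rw [ha, hb]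
    · subst ha; rw [f₂v, f₂n b hb] at hab; simp at hab
    · subst hb; rw [f₂v, f₂n a ha] at hab; simp at hab
    · rw [f₂n a ha, f₂n b hb] at hab; simpa using hab
  have e1 : ∀ a, windSum (wedge G₁ G₂ v₁ v₂) D (Sum.inl a) =
      windSum (wedge G₁ G₂ v₁ v₂) D (Sum.inl v₁) := by
    intro a
    refine wind_eq' (f := Sum.inl) Sum.inl_injective v₁ hn (H := G₁) ?_ ?_ h₁ D a v₁
    · intro a b
      simp only [wedge, SimpleGraph.fromRel_adj, ne_eq, Sum.inl.injEq]
      constructor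
      · rintro ⟨_, h | h⟩
        · exact h
        · exact h.symm
      · intro h; exact ⟨h.ne, Or.inl h⟩
    · rintro a (z | z) hz h
      · exact absurd ⟨z, rfl⟩ hz
      · simp only [wedge, SimpleGraph.fromRel_adj, or_false] at h
        exact h.2.1
  have e2 : ∀ a, windSum (wedge G₁ G₂ v₁ v₂) D (f₂ a) =
      windSum (wedge G₁ G₂ v₁ v₂) D (f₂ v₂) := by
    intro a
    refine wind_eq' (f := f₂) hf₂ v₂ hn (H := G₂) ?_ ?_ h₂ D a v₂
    · intro a b
      simp only [wedge, SimpleGraph.fromRel_adj]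
      rw [hf₂.ne_iff]
      by_cases ha : a = v₂ <;> by_cases hb : b = v₂
      · subst ha; subst hb; simp
      · subst ha; rw [f₂v, f₂n b hb]; simp only [or_false, true_and]
        exact ⟨fun h => h.2, fun h => ⟨h.ne, h⟩⟩
      · subst hb; rw [f₂v, f₂n a ha]; simp only [false_or, true_and]
        exact ⟨fun h => h.2.symm, fun h => ⟨h.ne, h.symm⟩⟩
      · rw [f₂n a ha, f₂n b hb]; simp only
        exact ⟨fun h => h.2.elim id (fun h => h.symm), fun h => ⟨h.ne, Or.inl h⟩⟩
    · rintro a (z | z) hz h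
      · by_contra ha
        rw [f₂n a ha] at h
        simp only [wedge, SimpleGraph.fromRel_adj, false_or] at h
        exact hz ⟨v₂, by rw [f₂v, h.2.1]⟩
      · exact absurd ⟨z.1, f₂n z.1 z.2⟩ hz
  have e3 : ∀ z, windSum (wedge G₁ G₂ v₁ v₂) D z =
      windSum (wedge G₁ G₂ v₁ v₂) D (Sum.inl v₁) := by
    rintro (z | z)
    · exact e1 z
    · have := e2 z.1
      rwa [f₂n z.1 z.2, f₂v] at this
  have hs := sum_wind hn (wedge G₁ G₂ v₁ v₂) D
  rw [Finset.sum_congr rfl (fun z _ => e3 z), Finset.sum_const, Finset.card_univ, nsmul_eq_mul] at hs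
  intro z
  rw [e3 z]
  exact (mul_eq_zero.1 hs).resolve_left (by exact_mod_cast hpos.ne')
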